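/- arXiv:quant-ph/0503083 — 2 statements merged into one kernel-verified Lean document; each statement's English description precedes it below -/
import Mathlib

section
/- Let (Σ, L, κ) be a state property system satisfying the axiom OrthoCom. For every p ∈ Σ, the classical state ω(p) is an atom of the lattice of classical properties: if a is a classical property with a ≤ ω(p) and a ≠ ⊥, then a = ω(p). -/
/-- A state property system `(σ, L, κ)` equipped with an orthocomplementation
satisfying the axiom **OrthoCom**. -/
structure OrthoSPS (σ : Type*) (L : Type*) [CompleteLattice L] where
  /-- the Cartan map -/
  κ : L → Set σ
  κ_bot : κ ⊥ = ∅
  κ_top : κ ⊤ = Set.univ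
  κ_sInf : ∀ s : Set L, κ (sInf s) = ⋂ a ∈ s, κ a
  le_iff : ∀ a b : L, a ≤ b ↔ κ a ⊆ κ b
  /-- the orthocomplementation -/
  perp : L → L
  perp_perp : ∀ a : L, perp (perp a) = a
  perp_anti : ∀ a b : L, a ≤ b → perp b ≤ perp a
  inf_perp : ∀ a : L, a ⊓ perp a = ⊥
  sup_perp : ∀ a : L, a ⊔ perp a = ⊤
  /-- axiom OrthoCom: any state orthogonal to every state in `κ a` lies in `κ (perp a)` -/
  orthoCom : ∀ (a : L) (q : σ),
    (∀ p ∈ κ a, ∃ b : L, q ∈ κ b ∧ p ∈ κ (perp b)) → q ∈ κ (perp a)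

namespace OrthoSPS

variable {σ : Type*} {L : Type*} [CompleteLattice L]

/-- orthogonality of two states: `p ⊥ q` -/
def PerpState (S : OrthoSPS σ L) (p q : σ) : Prop :=
  ∃ a : L, p ∈ S.κ a ∧ q ∈ S.κ (S.perp a)

/-- a property `a` is classical if every state is in `κ a` or in `κ (perp a)` -/
def IsClassical (S : OrthoSPS σ L) (a : L) : Prop :=
  ∀ p : σ, p ∈ S.κ a ∨ p ∈ S.κ (S.perp a)

/-- the classical state `ω p` of a state `p`: the infimum of all classical properties
actual in `p` -/
def classicalState (S : OrthoSPS σ L) (p : σ) : L :=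
  sInf {a : L | S.IsClassical a ∧ p ∈ S.κ a}

/-- `Ω`, the set of all classical states -/
def Omega (S : OrthoSPS σ L) : Set L :=
  Set.range S.classicalState

/-- the classical Cartan map `κ_c` -/
def κc (S : OrthoSPS σ L) (a : L) : Set L :=
  S.classicalState '' S.κ a

theorem IsClassical.perp {S : OrthoSPS σ L} {a : L} (ha : S.IsClassical a) :
    S.IsClassical (S.perp a) := fun p => by
  rw [S.perp_perp]
  exact (ha p).symm

theorem classicalState_le {S : OrthoSPS σ L} {p : σ} {a : L} (ha : S.IsClassical a)
    (hp : p ∈ S.κ a) : S.classicalState p ≤ a :=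
  sInf_le ⟨ha, hp⟩

end OrthoSPS

/-- each classical state `ω p` is an atom of the lattice of classical
properties. -/
theorem classicalState_atom {σ L : Type*} [CompleteLattice L] (S : OrthoSPS σ L)
    (p : σ) (a : L) (ha : S.IsClassical a) (hle : a ≤ S.classicalState p)
    (hne : a ≠ ⊥) : a = S.classicalState p := by
  rcases ha p with hp | hp
  · exact hle.antisymm (OrthoSPS.classicalState_le ha hp)
  · have hperp : a ≤ S.perp a := hle.trans (OrthoSPS.classicalState_le ha.perp hp)
    exact absurd ((inf_eq_left.mpr hperp).symm.trans (S.inf_perp a)) hne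
end

section
/- Let (Σ, L, κ) be a state property system satisfying the axiom OrthoCom. For every classical property a and every indexed family (x_i) in L, one has a ⊓ (⨆ i, x_i) = ⨆ i, (a ⊓ x_i). -/
namespace OrthoSPS

variable {σ : Type*} {L : Type*} [CompleteLattice L]

theorem κ_inf (S : OrthoSPS σ L) (a b : L) : S.κ (a ⊓ b) = S.κ a ∩ S.κ b := by
  rw [← sInf_pair, S.κ_sInf, Set.biInter_pair]

theorem κ_mono (S : OrthoSPS σ L) {a b : L} (h : a ≤ b) : S.κ a ⊆ S.κ b :=
  (S.le_iff a b).1 h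

/-- The join of `y` with the orthocomplement of a classical property `a` adds no state of `a`
outside `y`. -/
theorem IsClassical.inf_sup_perp_le {S : OrthoSPS σ L} {a : L} (ha : S.IsClassical a) (y : L) :
    a ⊓ (y ⊔ S.perp a) ≤ y := by
  have hz : a ⊓ S.perp y ≤ S.perp (y ⊔ S.perp a) := by
    rw [← S.perp_perp (a ⊓ S.perp y)]
    refine S.perp_anti _ _ (sup_le ?_ (S.perp_anti _ _ inf_le_left))
    simpa only [S.perp_perp] using S.perp_anti _ _ (inf_le_right : a ⊓ S.perp y ≤ S.perp y)
  rw [S.le_iff, S.κ_inf]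
  rintro p ⟨hpa, hpz⟩
  rw [← S.perp_perp y]
  refine S.orthoCom _ _ fun q hq => ?_
  rcases ha q with hqa | hqa
  · refine ⟨y ⊔ S.perp a, hpz, S.κ_mono hz ?_⟩
    rw [S.κ_inf]
    exact ⟨hqa, hq⟩
  · exact ⟨a, hpa, hqa⟩

theorem IsClassical.le_inf_sup_perp {S : OrthoSPS σ L} {a : L} (ha : S.IsClassical a) (x : L) :
    x ≤ (a ⊓ x) ⊔ S.perp a := by
  rw [S.le_iff]
  intro p hp
  rcases ha p with hpa | hpa
  · refine S.κ_mono le_sup_left ?_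
    rw [S.κ_inf]
    exact ⟨hpa, hp⟩
  · exact S.κ_mono le_sup_right hpa

end OrthoSPS

/-- a classical property distributes over arbitrary suprema:
`a ⊓ (⨆ i, x i) = ⨆ i, (a ⊓ x i)`. -/
theorem classical_inf_iSup {σ L : Type*} [CompleteLattice L] (S : OrthoSPS σ L)
    (a : L) (ha : S.IsClassical a) {ι : Type*} (x : ι → L) :
    a ⊓ (⨆ i, x i) = ⨆ i, (a ⊓ x i) := by
  refine le_antisymm ?_ (iSup_le fun i => inf_le_inf_left a (le_iSup x i))
  refine le_trans (inf_le_inf_left a (iSup_le fun i => ?_)) (ha.inf_sup_perp_le _)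
  exact (ha.le_inf_sup_perp (x i)).trans (sup_le_sup_right (le_iSup (fun i => a ⊓ x i) i) _)
end
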